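/- Assume Setup (*). Then for each colour d ∈ C_{12} with d ≠ α_{12}, there is at most one colour c ∈ C_{01} such that the monic B^{cd} is realized in G. -/

import Mathlib

/-!
Common framework: coloured multipartite graphs in a finite language `L`.
Colours are natural numbers; for each pair of distinct parts `i j : Fin m`
there is a finite nonempty colour set `C i j`.
-/

/-- A finite language for coloured `m`-partite graphs. -/
structure MLang (m : ℕ) where
  C : Fin m → Fin m → Finset ℕ
  symm : ∀ i j, C i j = C j i
  nonempty : ∀ i j, i ≠ j → (C i j).Nonempty

/-- A coloured `m`-partite `L`-graph: vertices partitioned into parts `V_0, …, V_{m-1}`,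
with a symmetric colouring of cross-part pairs taking values in the colour sets of `L`.
(The value of `colour` on pairs within a part is irrelevant junk data.) -/
structure LGraph {m : ℕ} (L : MLang m) where
  V : Type
  part : V → Fin m
  colour : V → V → ℕ
  colour_symm : ∀ x y, colour x y = colour y x
  colour_mem : ∀ x y, part x ≠ part y → colour x y ∈ L.C (part x) (part y)

namespace LGraph

variable {m : ℕ} {L : MLang m}

/-- The induced subgraph of `A` on a set `S` of its vertices. -/
def restrict (A : LGraph L) (S : Set A.V) : LGraph L where
  V := S
  part x := A.part x.1
  colour x y := A.colour x.1 y.1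
  colour_symm := fun x y => A.colour_symm x.1 y.1
  colour_mem := fun x y h => A.colour_mem x.1 y.1 h

/-- `f` is an embedding of `A` into `G`: injective, part-preserving, colour-preserving. -/
def IsEmbedding (A G : LGraph L) (f : A.V → G.V) : Prop :=
  Function.Injective f ∧ (∀ x, G.part (f x) = A.part x) ∧
    ∀ x y : A.V, A.part x ≠ A.part y → G.colour (f x) (f y) = A.colour x y

/-- `A` is realized in `G`, i.e. `A` embeds into `G`. -/
def Realized (G A : LGraph L) : Prop := ∃ f : A.V → G.V, IsEmbedding A G f

/-- `A` and `B` are isomorphic `L`-graphs. -/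
def IsIsomorphic (A B : LGraph L) : Prop :=
  ∃ f : A.V → B.V, IsEmbedding A B f ∧ Function.Surjective f

/-- `φ` restricted to `S` is an isomorphism between induced subgraphs of `G`
(a partial automorphism of `G`). -/
def IsPartialIso (G : LGraph L) (S : Set G.V) (φ : G.V → G.V) : Prop :=
  Set.InjOn φ S ∧ (∀ x ∈ S, G.part (φ x) = G.part x) ∧
    ∀ x ∈ S, ∀ y ∈ S, G.part x ≠ G.part y → G.colour (φ x) (φ y) = G.colour x y

/-- `G` is homogeneous: every isomorphism between finite induced subgraphs of `G`
extends to an automorphism of `G`. -/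
def Homogeneous (G : LGraph L) : Prop :=
  ∀ S : Set G.V, S.Finite → ∀ φ : G.V → G.V, G.IsPartialIso S φ →
    ∃ ψ : G.V ≃ G.V, (∀ x, G.part (ψ x) = G.part x) ∧
      (∀ x y : G.V, G.part x ≠ G.part y → G.colour (ψ x) (ψ y) = G.colour x y) ∧
      ∀ x ∈ S, ψ x = φ x

/-- `G` is `m`-generic: every part is countably infinite and every bipartite
restriction is generic. -/
def Generic (G : LGraph L) : Prop :=
  Countable G.V ∧ (∀ i : Fin m, {x : G.V | G.part x = i}.Infinite) ∧
    ∀ i j : Fin m, i ≠ j → ∀ U : Finset G.V, (∀ u ∈ U, G.part u = i) →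
      ∀ f : G.V → ℕ, (∀ u ∈ U, f u ∈ L.C i j) →
        ∃ x : G.V, G.part x = j ∧ ∀ u ∈ U, G.colour x u = f u

/-- `A` is minimally omitted from `G` (membership in `O(G)`): `A` is finite and omitted,
but every proper induced subgraph of `A` is realized in `G`. -/
def MinOmitted (G A : LGraph L) : Prop :=
  Finite A.V ∧ ¬ G.Realized A ∧ ∀ S : Set A.V, S ≠ Set.univ → G.Realized (A.restrict S)

/-- `A` is monic: at most one vertex in each part. -/
def Monic (A : LGraph L) : Prop := ∀ x y : A.V, A.part x = A.part y → x = y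

/-- `A` covers colour `c` on the restriction `V_i V_j`: it has vertices in `V_i` and `V_j`
joined by a `c`-coloured edge. -/
def Covers (A : LGraph L) (i j : Fin m) (c : ℕ) : Prop :=
  ∃ x y : A.V, A.part x = i ∧ A.part y = j ∧ A.colour x y = c

/-- `A` is an `ijk`-triangle: a monic with vertices in exactly the parts `V_i, V_j, V_k`. -/
def IsTriangleOn (A : LGraph L) (i j k : Fin m) : Prop :=
  A.Monic ∧ (∀ x : A.V, A.part x = i ∨ A.part x = j ∨ A.part x = k) ∧
    (∃ x : A.V, A.part x = i) ∧ (∃ x : A.V, A.part x = j) ∧ (∃ x : A.V, A.part x = k)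

/-- `A` is a triangle: an `ijk`-triangle for some pairwise distinct `i, j, k`. -/
def IsTriangle (A : LGraph L) : Prop :=
  ∃ i j k : Fin m, i ≠ j ∧ i ≠ k ∧ j ≠ k ∧ A.IsTriangleOn i j k

end LGraph

open LGraph

variable {m : ℕ} {L : MLang m}

/-- A `C_{ij}`-cover set: a set of monics covering every colour of `C i j` on `V_i V_j`. -/
def IsCoverSet (𝒜 : Set (LGraph L)) (i j : Fin m) : Prop :=
  (∀ A ∈ 𝒜, A.Monic) ∧ ∀ c ∈ L.C i j, ∃ A ∈ 𝒜, A.Covers i j c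

/-- A `C_{ij}^{kl}`-omission set with code `(i,j,k,l; cik, cil, cjk, cjl)`:
a `C_{ij}`-cover set of `ijk`-triangles and `ijl`-triangles all of whose
`E_{ik}, E_{il}, E_{jk}, E_{jl}`-edges have the indicated colours. -/
def IsOmissionSet (S : Set (LGraph L)) (i j k l : Fin m) (cik cil cjk cjl : ℕ) : Prop :=
  IsCoverSet S i j ∧
  (∀ A ∈ S, A.IsTriangleOn i j k ∨ A.IsTriangleOn i j l) ∧
  (∀ A ∈ S, ∀ x y : A.V, A.part x = i → A.part y = k → A.colour x y = cik) ∧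
  (∀ A ∈ S, ∀ x y : A.V, A.part x = i → A.part y = l → A.colour x y = cil) ∧
  (∀ A ∈ S, ∀ x y : A.V, A.part x = j → A.part y = k → A.colour x y = cjk) ∧
  (∀ A ∈ S, ∀ x y : A.V, A.part x = j → A.part y = l → A.colour x y = cjl)

/-- The code `(i,j,k,l; cik, cil, cjk, cjl)` is based on the cover set `𝒜`. -/
def BasedOn (𝒜 : Set (LGraph L)) (i j k l : Fin m) (cik cil cjk cjl : ℕ) : Prop :=
  ∃ A ∈ 𝒜, ∃ A' ∈ 𝒜,
    A.Covers i k cik ∧ A.Covers j k cjk ∧ A'.Covers i l cil ∧ A'.Covers j l cjl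

/-- The code `(i,j,k,l; cik, cil, cjk, cjl)` is based on triangles from the cover set `𝒜`. -/
def BasedOnTriangles (𝒜 : Set (LGraph L)) (i j k l : Fin m) (cik cil cjk cjl : ℕ) : Prop :=
  ∃ A ∈ 𝒜, ∃ A' ∈ 𝒜, A.IsTriangle ∧ A'.IsTriangle ∧
    A.Covers i k cik ∧ A.Covers j k cjk ∧ A'.Covers i l cil ∧ A'.Covers j l cjl

/-- The age of `G`: the class of finite `L`-graphs embedding into `G`. -/
def Age (G : LGraph L) : Set (LGraph L) := {A | Finite A.V ∧ G.Realized A}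

/-- `Forb F`: the class of finite `L`-graphs into which no member of `F` embeds. -/
def Forb (F : Set (LGraph L)) : Set (LGraph L) :=
  {B | Finite B.V ∧ ∀ A ∈ F, ¬ B.Realized A}

/-- An amalgamation class: a class of finite `L`-graphs closed under isomorphism and
induced subgraphs with the amalgamation property. -/
def IsAmalgamationClass (𝒞 : Set (LGraph L)) : Prop :=
  (∀ A ∈ 𝒞, Finite A.V) ∧
  (∀ A ∈ 𝒞, ∀ B : LGraph L, A.IsIsomorphic B → B ∈ 𝒞) ∧
  (∀ A ∈ 𝒞, ∀ S : Set A.V, A.restrict S ∈ 𝒞) ∧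
  ∀ A B₁ B₂ : LGraph L, A ∈ 𝒞 → B₁ ∈ 𝒞 → B₂ ∈ 𝒞 →
    ∀ (f₁ : A.V → B₁.V) (f₂ : A.V → B₂.V),
      IsEmbedding A B₁ f₁ → IsEmbedding A B₂ f₂ →
      ∃ C ∈ 𝒞, ∃ (g₁ : B₁.V → C.V) (g₂ : B₂.V → C.V),
        IsEmbedding B₁ C g₁ ∧ IsEmbedding B₂ C g₂ ∧ g₁ ∘ f₁ = g₂ ∘ f₂

section Parts01

variable [NeZero m]

/-- `A ≤₀₁ B`: `A` is an off-`E_{01}`-subgraph of `B`, i.e. `A` embeds into `B` ignoring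
the colours of edges between `V_0` and `V_1` (equivalently, `A` embeds into the graph
obtained from `B` by recolouring its `E_{01}`-edge with the `E_{01}`-colour of `A`). -/
def Le01 (A B : LGraph L) : Prop :=
  ∃ f : A.V → B.V, Function.Injective f ∧ (∀ x, B.part (f x) = A.part x) ∧
    ∀ x y : A.V, A.part x ≠ A.part y →
      ¬((A.part x = 0 ∧ A.part y = 1) ∨ (A.part x = 1 ∧ A.part y = 0)) →
      B.colour (f x) (f y) = A.colour x y

/-- `A` and `B` are off-`E_{01}`-isomorphic. -/
def OffIso01 (A B : LGraph L) : Prop := Le01 A B ∧ Le01 B A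

/-- `A` is a maximal element of the quasi-order `(𝒜, ≤₀₁)`. -/
def MaxIn (𝒜 : Set (LGraph L)) (A : LGraph L) : Prop :=
  A ∈ 𝒜 ∧ ∀ B ∈ 𝒜, Le01 A B → Le01 B A

/-- `𝒜 ∈ Λ`: a `C_{01}`-cover set contained in `O(G)` of size exactly `|C_{01}|`. -/
def InLambda (G : LGraph L) (𝒜 : Set (LGraph L)) : Prop :=
  (∀ A ∈ 𝒜, G.MinOmitted A) ∧ IsCoverSet 𝒜 0 1 ∧ 𝒜.ncard = (L.C 0 1).card

/-- The graph obtained from `A` by recolouring its `E_{01}`-edge with `α`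
(that is, `A^{c/α}` where `c` is the `E_{01}`-colour of `A`) is realized in `G`. -/
def RealizedRecoloured01 (G A : LGraph L) (α : ℕ) : Prop :=
  ∃ f : A.V → G.V, Function.Injective f ∧ (∀ x, G.part (f x) = A.part x) ∧
    (∀ x y : A.V, A.part x ≠ A.part y →
      ¬((A.part x = 0 ∧ A.part y = 1) ∨ (A.part x = 1 ∧ A.part y = 0)) →
      G.colour (f x) (f y) = A.colour x y) ∧
    ∀ x y : A.V, A.part x = 0 → A.part y = 1 → G.colour (f x) (f y) = α

/-- `Ω₀₁(𝒜) ⊆ Ω₀₁(ℬ)`: every code `(0,1,k,l; c_{0k}, c_{0l}, c_{1k}, c_{1l})`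
based on `𝒜` is based on `ℬ`. -/
def Omega01Le (𝒜 ℬ : Set (LGraph L)) : Prop :=
  ∀ k l : Fin m, k ≠ l → k ≠ 0 → k ≠ 1 → l ≠ 0 → l ≠ 1 →
    ∀ c0k c0l c1k c1l : ℕ,
      BasedOn 𝒜 0 1 k l c0k c0l c1k c1l → BasedOn ℬ 0 1 k l c0k c0l c1k c1l

/-- `ℬ` is a good `C_{01}`-cover set (for `G`): there is a key colour `α ∈ C_{01}` with key
monic `A^α ∈ ℬ` such that every member of `ℬ`, after recolouring its `E_{01}`-edge by `α`,
is either an (off-`E_{01}`-)subgraph of `A^α` or realized in `G`. -/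
def GoodCoverSet (G : LGraph L) (ℬ : Set (LGraph L)) : Prop :=
  ∃ α ∈ L.C 0 1, ∃ Aα ∈ ℬ, Aα.Covers 0 1 α ∧
    ∀ A ∈ ℬ, Le01 A Aα ∨ RealizedRecoloured01 G A α

/-- `ℬ` is a star `C_{01}`-cover set: good, with a key monic which either has vertices
in at least four parts, or has vertices in exactly three parts `V_0, V_1, V_i` while no
other member of `ℬ` has vertices in all of the remaining parts. -/
def StarCoverSet (G : LGraph L) (ℬ : Set (LGraph L)) : Prop :=
  ∃ α ∈ L.C 0 1, ∃ Aα ∈ ℬ, Aα.Covers 0 1 α ∧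
    (∀ A ∈ ℬ, Le01 A Aα ∨ RealizedRecoloured01 G A α) ∧
    (4 ≤ (Set.range Aα.part).ncard ∨
      ∃ i : Fin m, i ≠ 0 ∧ i ≠ 1 ∧ Set.range Aα.part = {0, 1, i} ∧
        ∀ B ∈ ℬ, B ≠ Aα → ∃ p : Fin m, p ≠ 0 ∧ p ≠ 1 ∧ p ≠ i ∧ p ∉ Set.range B.part)

/-- `B` is a copy of the monic `B^{cd}` (relative to the background colours `α`): a monic
with exactly one vertex in every part, `E_{01}`-colour `c`, `E_{12}`-colour `d`, and
`E_{ij}`-colour `α i j` for every other pair of distinct parts. -/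
def IsBcd (B : LGraph L) (α : Fin m → Fin m → ℕ) (c d : ℕ) : Prop :=
  B.Monic ∧ (∀ i : Fin m, ∃ x : B.V, B.part x = i) ∧
  (∀ x y : B.V, B.part x = 0 → B.part y = 1 → B.colour x y = c) ∧
  (∀ x y : B.V, B.part x = 1 → B.part y = 2 → B.colour x y = d) ∧
  (∀ x y : B.V, B.part x ≠ B.part y →
    ¬((B.part x = 0 ∧ B.part y = 1) ∨ (B.part x = 1 ∧ B.part y = 0)) →
    ¬((B.part x = 1 ∧ B.part y = 2) ∨ (B.part x = 2 ∧ B.part y = 1)) →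
    B.colour x y = α (B.part x) (B.part y))

end Parts01

namespace LGraph

/-- `H` restricted to `S` embeds into `G`, by a total function. -/
def RealOn {m : ℕ} {L : MLang m} (G H : LGraph L) (S : Set H.V) : Prop :=
  ∃ f : H.V → G.V, Set.InjOn f S ∧ (∀ x ∈ S, G.part (f x) = H.part x) ∧
    ∀ x ∈ S, ∀ y ∈ S, H.part x ≠ H.part y → G.colour (f x) (f y) = H.colour x y

theorem realOn_iff {m : ℕ} {L : MLang m} (G H : LGraph L) [Nonempty G.V] (S : Set H.V) :
    G.RealOn H S ↔ G.Realized (H.restrict S) := by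
  classical
  constructor
  · rintro ⟨f, h1, h2, h3⟩
    refine ⟨fun x => f x.1, ?_, ?_, ?_⟩
    · intro x y hxy
      exact Subtype.ext (h1 x.2 y.2 hxy)
    · intro x
      exact h2 x.1 x.2
    · intro x y h
      exact h3 x.1 x.2 y.1 y.2 h
  · rintro ⟨f, h1, h2, h3⟩
    let g : H.V → G.V := fun x => if h : x ∈ S then f ⟨x, h⟩ else Classical.arbitrary _
    have hg : ∀ x (h : x ∈ S), g x = f ⟨x, h⟩ := fun x h => by simp [g, h]
    refine ⟨g, ?_, ?_, ?_⟩
    · intro x hx y hy hxy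
      rw [hg x hx, hg y hy] at hxy
      exact congrArg Subtype.val (h1 hxy)
    · intro x hx
      rw [hg x hx]
      exact h2 ⟨x, hx⟩
    · intro x hx y hy h
      rw [hg x hx, hg y hy]
      exact h3 ⟨x, hx⟩ ⟨y, hy⟩ h

/-- Two-point amalgamation inside one part. -/
theorem realOn_amalg {m : ℕ} {L : MLang m} (G H : LGraph L) [Nonempty G.V]
    (hG : G.Homogeneous) [Finite H.V] (S : Set H.V) (p q w : H.V)
    (hp : p ∈ S) (hq : q ∈ S) (hw : w ∈ S)
    (hpq : H.part p = H.part q) (hpw : H.part p ≠ H.part w)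
    (hc : H.colour p w ≠ H.colour q w)
    (h1 : G.RealOn H (S \ {p})) (h2 : G.RealOn H (S \ {q})) : G.RealOn H S := by
  classical
  obtain ⟨f, f1, f2, f3⟩ := h1
  obtain ⟨g, g1, g2, g3⟩ := h2
  have hpq' : p ≠ q := by rintro rfl; exact hc rfl
  have hwp : w ≠ p := by rintro rfl; exact hpw rfl
  have hwq : w ≠ q := by rintro rfl; exact hpw hpq
  set T : Set H.V := (S \ {p}) \ {q} with hT
  have hT1 : T ⊆ S \ {p} := Set.sdiff_subset
  have hT2 : T ⊆ S \ {q} := fun x hx => ⟨hx.1.1, hx.2⟩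
  haveI : Nonempty H.V := ⟨p⟩
  have hinv : ∀ x ∈ T, Function.invFunOn f T (f x) = x := fun x hx =>
    (f1.mono hT1).leftInvOn_invFunOn hx
  have hpi : G.IsPartialIso (f '' T) (fun v => g (Function.invFunOn f T v)) := by
    refine ⟨?_, ?_, ?_⟩
    · rintro _ ⟨x, hx, rfl⟩ _ ⟨y, hy, rfl⟩ hxy
      simp only [hinv x hx, hinv y hy] at hxy
      rw [g1 (hT2 hx) (hT2 hy) hxy]
    · rintro _ ⟨x, hx, rfl⟩
      simp only [hinv x hx]
      rw [g2 x (hT2 hx), f2 x (hT1 hx)]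
    · rintro _ ⟨x, hx, rfl⟩ _ ⟨y, hy, rfl⟩ hxy
      simp only [hinv x hx, hinv y hy]
      rw [f2 x (hT1 hx), f2 y (hT1 hy)] at hxy
      rw [g3 x (hT2 hx) y (hT2 hy) hxy, f3 x (hT1 hx) y (hT1 hy) hxy]
  obtain ⟨ψ, p1, p2, p3⟩ := hG (f '' T) (Set.toFinite _) _ hpi
  have hψ : ∀ x ∈ T, ψ (f x) = g x := by
    intro x hx
    rw [p3 _ ⟨x, hx, rfl⟩, hinv x hx]
  let h : H.V → G.V := fun v => if v = p then g p else ψ (f v)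
  have hh1 : ∀ v, v ≠ p → h v = ψ (f v) := fun v hv => by simp [h, hv]
  have hh2 : ∀ v ∈ S, v ≠ q → h v = g v := by
    intro v hv hvq
    by_cases hvp : v = p
    · simp [h, hvp]
    · rw [hh1 v hvp]
      exact hψ v ⟨⟨hv, hvp⟩, hvq⟩
  have hpart : ∀ x ∈ S, G.part (h x) = H.part x := by
    intro x hx
    by_cases hxp : x = p
    · subst hxp
      rw [hh2 x hx hpq', g2 x ⟨hx, hpq'⟩]
    · rw [hh1 x hxp, p1, f2 x ⟨hx, hxp⟩]
  have hcol : ∀ x ∈ S, ∀ y ∈ S, H.part x ≠ H.part y →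
      G.colour (h x) (h y) = H.colour x y := by
    intro x hx y hy hxy
    by_cases hA : x ≠ p ∧ y ≠ p
    · rw [hh1 x hA.1, hh1 y hA.2, p2, f3 x ⟨hx, hA.1⟩ y ⟨hy, hA.2⟩ hxy]
      rwa [f2 x ⟨hx, hA.1⟩, f2 y ⟨hy, hA.2⟩]
    · have hB : x ≠ q ∧ y ≠ q := by
        constructor
        · rintro rfl
          apply hA
          refine ⟨hpq'.symm, ?_⟩
          rintro rfl
          exact hxy hpq.symm
        · rintro rfl
          apply hA
          refine ⟨?_, hpq'.symm⟩
          rintro rfl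
          exact hxy hpq
      rw [hh2 x hx hB.1, hh2 y hy hB.2, g3 x ⟨hx, hB.1⟩ y ⟨hy, hB.2⟩ hxy]
  have hne : h p ≠ h q := by
    intro he
    apply hc
    rw [← hcol p hp w hw hpw, ← hcol q hq w hw (hpq ▸ hpw), he]
  refine ⟨h, ?_, hpart, hcol⟩
  intro x hx y hy hxy
  by_cases hA : x ≠ p ∧ y ≠ p
  · rw [hh1 x hA.1, hh1 y hA.2] at hxy
    exact f1 ⟨hx, hA.1⟩ ⟨hy, hA.2⟩ (ψ.injective hxy)
  · by_cases hB : x ≠ q ∧ y ≠ q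
    · rw [hh2 x hx hB.1, hh2 y hy hB.2] at hxy
      exact g1 ⟨hx, hB.1⟩ ⟨hy, hB.2⟩ hxy
    · exfalso
      grind

theorem RealOn.mono {m : ℕ} {L : MLang m} {G H : LGraph L} {S T : Set H.V}
    (h : G.RealOn H S) (hTS : T ⊆ S) : G.RealOn H T := by
  obtain ⟨f, f1, f2, f3⟩ := h
  exact ⟨f, f1.mono hTS, fun x hx => f2 x (hTS hx),
    fun x hx y hy => f3 x (hTS hx) y (hTS hy)⟩

/-- Small graphs which are not monochromatic between some parts and whose monics are all
realized are realized. -/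
theorem realOn_small {m : ℕ} {L : MLang m} (G H : LGraph L) [Nonempty G.V]
    (hG : G.Homogeneous) [Finite H.V] (n : ℕ)
    (hmin : ∀ B : LGraph L, G.MinOmitted B → ¬ B.Monic → n ≤ Nat.card B.V)
    (hmon : ∀ T : Set H.V, (H.restrict T).Monic → G.RealOn H T)
    (S : Set H.V) (hS : S.ncard ≤ n) (p q w : H.V)
    (hp : p ∈ S) (hq : q ∈ S) (hw : w ∈ S)
    (hpq : H.part p = H.part q) (hpw : H.part p ≠ H.part w)
    (hc : H.colour p w ≠ H.colour q w) : G.RealOn H S := by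
  by_contra hS'
  obtain ⟨T, hTS, hT⟩ := Set.Finite.exists_le_minimal
    (Set.toFinite {T : Set H.V | ¬ G.RealOn H T}) (a := S) hS'
  have hTm : ∀ U : Set H.V, U ⊆ T → U ≠ T → G.RealOn H U := by
    intro U hU hne
    by_contra hU'
    exact hne (hU.antisymm (hT.2 hU' hU))
  have hmo : G.MinOmitted (H.restrict T) := by
    refine ⟨?_, ?_, ?_⟩
    · change Finite T
      infer_instance
    · rw [← realOn_iff]
      exact hT.1
    · intro U hU
      have hU2 : G.RealOn H (Subtype.val '' (U : Set T)) := by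
        apply hTm
        · rintro _ ⟨x, -, rfl⟩
          exact x.2
        · intro he
          apply hU
          ext x
          simp only [Set.mem_univ, iff_true]
          have hx : (x : T).1 ∈ (Subtype.val '' (U : Set T)) := by
            rw [he]; exact (x : T).2
          obtain ⟨y, hy, hyx⟩ := hx
          rwa [← (Subtype.ext hyx : y = x)]
      obtain ⟨f, f1, f2, f3⟩ := hU2
      refine ⟨fun x => f x.1.1, ?_, ?_, ?_⟩
      · intro x y hxy
        exact Subtype.ext (Subtype.ext (f1 ⟨x.1, x.2, rfl⟩ ⟨y.1, y.2, rfl⟩ hxy))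
      · intro x
        exact f2 _ ⟨x.1, x.2, rfl⟩
      · intro x y h
        exact f3 _ ⟨x.1, x.2, rfl⟩ _ ⟨y.1, y.2, rfl⟩ h
  have hcard : n ≤ T.ncard := hmin _ hmo (fun hm => hT.1 (hmon T hm))
  have hTeq : T = S := Set.eq_of_subset_of_ncard_le hTS (hS.trans hcard) (Set.toFinite _)
  subst hTeq
  apply hS'
  refine realOn_amalg G H hG T p q w hp hq hw hpq hpw hc ?_ ?_
  · exact hTm _ Set.sdiff_subset (fun he => (he.symm.subset hp : p ∈ T \ {p}).2 rfl)
  · exact hTm _ Set.sdiff_subset (fun he => (he.symm.subset hq : q ∈ T \ {q}).2 rfl)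

open Classical in
/-- Colours from the extra vertex. -/
noncomputable def extCol {m : ℕ} [NeZero m] {L : MLang m} (A : LGraph L)
    (α : Fin m → Fin m → ℕ) (a : A.V) (c₁ c₂ d : ℕ) (x : A.V) : ℕ :=
  if A.part x = 0 then (if x = a then c₁ else c₂)
  else if A.part x = 2 then d else α 1 (A.part x)

/-- `A` with one extra vertex in part 1. -/
noncomputable def ext1 {m : ℕ} [NeZero m] {L : MLang m} (A : LGraph L)
    (α : Fin m → Fin m → ℕ) (a : A.V) (c₁ c₂ d : ℕ)
    (hmem : ∀ x, A.part x ≠ 1 → A.extCol α a c₁ c₂ d x ∈ L.C 1 (A.part x)) : LGraph L where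
  V := Option A.V
  part x := x.elim 1 A.part
  colour x y := match x, y with
    | none, none => 0
    | none, some y => A.extCol α a c₁ c₂ d y
    | some x, none => A.extCol α a c₁ c₂ d x
    | some x, some y => A.colour x y
  colour_symm := by
    rintro (_ | x) (_ | y)
    · rfl
    · rfl
    · rfl
    · exact A.colour_symm x y
  colour_mem := by
    rintro (_ | x) (_ | y) h
    · exact absurd rfl h
    · exact hmem y (Ne.symm h)
    · change _ ∈ L.C (A.part x) 1
      rw [L.symm]
      exact hmem x h
    · exact A.colour_mem x y h

end LGraph

/-- Under Setup (*), for each `d ∈ C_{12} - {α_{12}}` there is at most one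
colour `c ∈ C_{01}` such that the monic `B^{cd}` is realized in `G`. -/
theorem at_most_one_Bcd_realized
    {m : ℕ} [NeZero m] {L : MLang m} (hm : 3 ≤ m)
    (hIH : ∀ m' : ℕ, 3 ≤ m' → m' < m → ∀ L' : MLang m', ∀ G' : LGraph L',
      G'.Homogeneous → G'.Generic → ∀ B : LGraph L', G'.MinOmitted B → B.Monic)
    (G : LGraph L) (hG : G.Homogeneous) (hgen : G.Generic)
    (A : LGraph L) (hA : G.MinOmitted A) (hAnm : ¬ A.Monic)
    (hmin : ∀ B : LGraph L, G.MinOmitted B → ¬ B.Monic → Nat.card A.V ≤ Nat.card B.V)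
    (α : Fin m → Fin m → ℕ)
    (hα : ∀ x y : A.V, A.part x ≠ A.part y → A.colour x y = α (A.part x) (A.part y))
    (hall : ∀ i : Fin m, ∃ x : A.V, A.part x = i)
    (hV0 : ∃ a b : A.V, a ≠ b ∧ A.part a = 0 ∧ A.part b = 0) :
    ∀ d ∈ L.C 1 2, d ≠ α 1 2 → ∀ c₁ ∈ L.C 0 1, ∀ c₂ ∈ L.C 0 1,
      (∃ B : LGraph L, IsBcd B α c₁ d ∧ G.Realized B) →
      (∃ B : LGraph L, IsBcd B α c₂ d ∧ G.Realized B) → c₁ = c₂ := by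
  classical
  intro d hd hdα c₁ hc₁ c₂ hc₂ hB₁ hB₂
  by_contra hcc
  obtain ⟨a, b, hab, ha, hb⟩ := hV0
  haveI : Finite A.V := hA.1
  haveI : Nonempty G.V := ⟨(hgen.2.1 0).nonempty.some⟩
  obtain ⟨k, rfl⟩ : ∃ k, m = k + 3 := ⟨m - 3, by omega⟩
  have h01 : (0 : Fin (k + 3)) ≠ 1 := by
    intro h
    have := congrArg Fin.val h
    simp at this
  have h02 : (0 : Fin (k + 3)) ≠ 2 := by
    intro h
    have := congrArg Fin.val h
    rw [Fin.coe_ofNat_eq_mod, Fin.coe_ofNat_eq_mod, Nat.mod_eq_of_lt (by omega),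
      Nat.mod_eq_of_lt (by omega)] at this
    omega
  have h12 : (1 : Fin (k + 3)) ≠ 2 := by
    intro h
    have := congrArg Fin.val h
    rw [Fin.coe_ofNat_eq_mod, Fin.coe_ofNat_eq_mod, Nat.mod_eq_of_lt (by omega),
      Nat.mod_eq_of_lt (by omega)] at this
    omega
  obtain ⟨z, hz⟩ := hall 1
  obtain ⟨w, hw⟩ := hall 2
  have hmem : ∀ x, A.part x ≠ 1 → A.extCol α a c₁ c₂ d x ∈ L.C 1 (A.part x) := by
    intro x hx
    unfold extCol
    split_ifs with h0 h1 h2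
    · rw [h0, L.symm]; exact hc₁
    · rw [h0, L.symm]; exact hc₂
    · rw [h2]; exact hd
    · have hzx : A.part z ≠ A.part x := by rw [hz]; exact hx.symm
      have := A.colour_mem z x hzx
      rwa [hα z x hzx, hz] at this
  let H : LGraph L := A.ext1 α a c₁ c₂ d hmem
  haveI : Finite H.V := inferInstanceAs (Finite (Option A.V))
  have hmon : ∀ T : Set H.V, (H.restrict T).Monic → G.RealOn H T := by
    intro T hT
    have hT' : ∀ x ∈ T, ∀ y ∈ T, H.part x = H.part y → x = y := fun x hx y hy h =>
      congrArg Subtype.val (hT ⟨x, hx⟩ ⟨y, hy⟩ h)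
    by_cases hn : (none : Option A.V) ∈ T
    · have key : ∃ c, (∀ x : A.V, some x ∈ T → A.part x = 0 → A.extCol α a c₁ c₂ d x = c) ∧
          ∃ B : LGraph L, IsBcd B α c d ∧ G.Realized B := by
        by_cases hat : (some a : Option A.V) ∈ T
        · refine ⟨c₁, ?_, hB₁⟩
          intro x hx hx0
          have : (some x : Option A.V) = some a := hT' _ hx _ hat (hx0.trans ha.symm)
          simp only [Option.some.injEq] at this
          simp [extCol, this, ha]
        · refine ⟨c₂, ?_, hB₂⟩
          intro x hx hx0
          have : x ≠ a := by rintro rfl; exact hat hx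
          simp [extCol, this, hx0]
      obtain ⟨c, hc, B, ⟨hBm, hBall, hB01, hB12, hBo⟩, f, f1, f2, f3⟩ := key
      choose v hv using hBall
      have hcol0 : ∀ y : A.V, some y ∈ T → A.part y ≠ 1 →
          B.colour (v 1) (v (A.part y)) = A.extCol α a c₁ c₂ d y := by
        intro y hy hy1
        by_cases h0 : A.part y = 0
        · rw [hc y hy h0, h0, B.colour_symm]
          exact hB01 _ _ (hv 0) (hv 1)
        · by_cases h2 : A.part y = 2
          · rw [h2, hB12 _ _ (hv 1) (hv 2)]
            simp [extCol, h2, h02.symm]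
          · rw [hBo]
            · simp [extCol, h0, h2, hv]
            · rw [hv, hv]; exact hy1.symm
            · simp only [hv]; tauto
            · simp only [hv]; tauto
      have hcol1 : ∀ x : A.V, some x ∈ T → A.part x ≠ 1 := by
        intro x hx h
        have : (some x : Option A.V) = none := hT' _ hx _ hn h
        simp at this
      refine ⟨fun x => f (v (H.part x)), ?_, ?_, ?_⟩
      · intro x hx y hy hxy
        apply hT' x hx y hy
        have := congrArg B.part (f1 hxy)
        rwa [hv, hv] at this
      · intro x _
        rw [f2, hv]
      · intro x hx y hy hxy
        change G.colour (f (v (H.part x))) (f (v (H.part y))) = _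
        rw [f3 _ _ (by rw [hv, hv]; exact hxy)]
        rcases x with _ | x <;> rcases y with _ | y
        · exact absurd rfl hxy
        · exact hcol0 y hy (hcol1 y hy)
        · rw [B.colour_symm]
          exact hcol0 x hx (hcol1 x hx)
        · change B.colour (v (A.part x)) (v (A.part y)) = A.colour x y
          have hx1 := hcol1 x hx
          have hy1 := hcol1 y hy
          rw [hα x y hxy, hBo]
          · rw [hv, hv]
          · rw [hv, hv]; exact hxy
          · simp only [hv]; tauto
          · simp only [hv]; tauto
    · have hU : {x : A.V | (some x : Option A.V) ∈ T} ≠ Set.univ := by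
        intro he
        have h1 : (some a : Option A.V) ∈ T := he.symm.subset (Set.mem_univ a)
        have h2 : (some b : Option A.V) ∈ T := he.symm.subset (Set.mem_univ b)
        have : (some a : Option A.V) = some b := hT' _ h1 _ h2 (ha.trans hb.symm)
        exact hab (Option.some.inj this)
      obtain ⟨f, f1, f2, f3⟩ := (realOn_iff G A _).2 (hA.2.2 _ hU)
      refine ⟨fun x => Option.elim x (Classical.arbitrary _) f, ?_, ?_, ?_⟩
      · rintro (_ | x) hx (_ | y) hy hxy
        · rfl
        · exact absurd hx hn
        · exact absurd hy hn
        · exact congrArg some (f1 hx hy hxy)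
      · rintro (_ | x) hx
        · exact absurd hx hn
        · exact f2 x hx
      · rintro (_ | x) hx (_ | y) hy hxy
        · exact absurd hx hn
        · exact absurd hx hn
        · exact absurd hy hn
        · exact f3 x hx y hy hxy
  have hsmall : ∀ u : A.V, A.part u = 0 → G.RealOn H (Set.univ \ {(some u : Option A.V)}) := by
    intro u hu
    refine realOn_small G H hG (Nat.card A.V) hmin hmon _ ?_ (none : Option A.V)
      (some z : Option A.V) (some w : Option A.V) ?_ ?_ ?_ ?_ ?_ ?_
    · have h1 := Set.ncard_sdiff_singleton_of_mem (Set.mem_univ (some u : Option A.V))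
      have h2 : Nat.card (Option A.V) = Nat.card A.V + 1 := Finite.card_option
      rw [Set.ncard_univ, h2] at h1
      exact h1.le
    · exact ⟨trivial, fun h => Option.some_ne_none u (Eq.symm h)⟩
    · refine ⟨trivial, fun h => ?_⟩
      have : z = u := Option.some.inj h
      exact h01 (by rw [← hu, ← hz, this])
    · refine ⟨trivial, fun h => ?_⟩
      have : w = u := Option.some.inj h
      exact h02 (by rw [← hu, ← hw, this])
    · exact hz.symm
    · change (1 : Fin (k + 3)) ≠ A.part w
      rw [hw]; exact h12
    · change A.extCol α a c₁ c₂ d w ≠ A.colour z w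
      rw [hα z w (by rw [hz, hw]; exact h12), hz, hw]
      simpa [extCol, hw, h02.symm] using hdα
  have hfull : G.RealOn H Set.univ := by
    refine realOn_amalg G H hG Set.univ (some a : Option A.V) (some b : Option A.V)
      (none : Option A.V) trivial trivial trivial (ha.trans hb.symm) ?_ ?_
      (hsmall a ha) (hsmall b hb)
    · change A.part a ≠ 1
      rw [ha]; exact h01
    · change A.extCol α a c₁ c₂ d a ≠ A.extCol α a c₁ c₂ d b
      simpa [extCol, ha, hb, hab.symm] using hcc
  obtain ⟨f, f1, f2, f3⟩ := hfull
  apply hA.2.1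
  refine ⟨fun x => f (some x : Option A.V), ?_, ?_, ?_⟩
  · intro x y hxy
    exact Option.some.inj (f1 (Set.mem_univ _) (Set.mem_univ _) hxy)
  · intro x
    exact f2 (some x : Option A.V) trivial
  · intro x y h
    exact f3 (some x : Option A.V) trivial (some y : Option A.V) trivial h
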